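/- There is no homeomorphism h : ℤ₂ → ℤ₃ such that h (x + 1) = h x + 1 for all x ∈ ℤ₂; that is, the 2-adic odometer and the 3-adic odometer are not topologically conjugate. -/

import Mathlib

/-- For distinct primes `p` and `q`, no continuous map `ℤ_[p] → ℤ_[q]` commutes with `x ↦ x + 1`:
it would send the null sequence `p ^ n` to a translate of the sequence `p ^ n` of units. -/
theorem PadicInt.not_semiconj_add_one_of_continuous {p q : ℕ} [Fact p.Prime] [Fact q.Prime]
    (hpq : p ≠ q) {h : ℤ_[p] → ℤ_[q]} (hc : Continuous h) :
    ¬ ∀ x, h (x + 1) = h x + 1 := by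
  intro hadd
  have hnat (n : ℕ) : h n = h 0 + n := by
    induction n with
    | zero => simp
    | succ n ih => rw [Nat.cast_succ, hadd, ih, Nat.cast_succ, add_assoc]
  have hp : Filter.Tendsto (fun n : ℕ ↦ (p : ℤ_[p]) ^ n) Filter.atTop (nhds 0) :=
    tendsto_pow_atTop_nhds_zero_of_norm_lt_one (by
      simpa using inv_lt_one_of_one_lt₀ (Nat.one_lt_cast.mpr (Fact.out : p.Prime).one_lt))
  have hq : Filter.Tendsto (fun n : ℕ ↦ (p : ℤ_[q]) ^ n) Filter.atTop (nhds 0) := by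
    have hlim := ((hc.tendsto 0).comp hp).sub_const (h 0)
    rw [sub_self] at hlim
    refine hlim.congr fun n ↦ ?_
    have hpow := hnat (p ^ n)
    push_cast at hpow
    simp [hpow]
  have hnorm : ‖(p : ℤ_[q])‖ = 1 :=
    PadicInt.norm_natCast_eq_one_iff.mpr
      ((Nat.coprime_primes Fact.out Fact.out).mpr hpq.symm)
  have hone := hq.norm
  simp only [norm_pow, hnorm, one_pow, norm_zero] at hone
  exact one_ne_zero (tendsto_nhds_unique tendsto_const_nhds hone)

/-- The 2-adic and 3-adic odometers are not topologically conjugate: there is no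
homeomorphism `h : ℤ_[2] ≃ₜ ℤ_[3]` with `h (x + 1) = h x + 1` for all `x`. -/
theorem not_exists_conjugacy_padic_two_three :
    ¬ ∃ h : ℤ_[2] ≃ₜ ℤ_[3], ∀ x : ℤ_[2], h (x + 1) = h x + 1 := by
  rintro ⟨h, hadd⟩
  exact PadicInt.not_semiconj_add_one_of_continuous (by norm_num) h.continuous hadd
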